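/- Let d ≥ 2 and let Γ be a finite-index subgroup of SL(d,ℤ). There exists a constant C₉ > 1 such that for every R > 2 and every g ∈ SL(d,ℝ) with s(g) ≥ 1/R, there exists γ ∈ Γ such that the operator norms (with respect to the Euclidean norm on ℝ^d) satisfy ‖γ·g‖ ≤ R^{C₉} and ‖(γ·g)^{−1}‖ ≤ R^{C₉}. -/

import Mathlib

open Matrix

/-- The Euclidean norm of a vector in `ℝ^d`. -/
noncomputable def euclNorm {d : ℕ} (v : Fin d → ℝ) : ℝ :=
  Real.sqrt (∑ i, v i ^ 2)

/-- The systole of a matrix `g`: the length of a shortest nonzero vector of the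
lattice `ℤ^d · g`. -/
noncomputable def systole {d : ℕ} (g : Matrix (Fin d) (Fin d) ℝ) : ℝ :=
  sInf {r : ℝ | ∃ v : Fin d → ℤ, v ≠ 0 ∧ r = euclNorm ((fun i => (v i : ℝ)) ᵥ* g)}

/-- The operator norm of a matrix acting on Euclidean `ℝ^d`. -/
noncomputable def opNorm {d : ℕ} (M : Matrix (Fin d) (Fin d) ℝ) : ℝ :=
  sSup {r : ℝ | ∃ v : Fin d → ℝ, euclNorm v ≤ 1 ∧ r = euclNorm (M.mulVec v)}

/-- The canonical morphism `SL(d,ℤ) →* SL(d,ℝ)`. -/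
noncomputable def toSLR {d : ℕ} :
    Matrix.SpecialLinearGroup (Fin d) ℤ →* Matrix.SpecialLinearGroup (Fin d) ℝ :=
  Matrix.SpecialLinearGroup.map (Int.castRingHom ℝ)

/-- **Minkowski's theorem** for the unit cube: a unimodular lattice contains a nonzero vector of
sup norm at most one. -/
theorem exists_ne_zero_norm_vecMul_le_one {d : ℕ} (hd : 0 < d) (h : Matrix (Fin d) (Fin d) ℝ)
    (hdet : h.det = 1) :
    ∃ v : Fin d → ℤ, v ≠ 0 ∧ ‖(fun i => (v i : ℝ)) ᵥ* h‖ ≤ 1 := by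
  have : Nonempty (Fin d) := ⟨⟨0, hd⟩⟩
  have hli : LinearIndependent ℝ h.row :=
    linearIndependent_rows_iff_isUnit.2 ((isUnit_iff_isUnit_det _).2 (by simp [hdet]))
  let b := basisOfLinearIndependentOfCardEqFinrank hli (by simp)
  have hb : (b : Fin d → Fin d → ℝ) = h := coe_basisOfLinearIndependentOfCardEqFinrank hli _
  have hvol : MeasureTheory.volume (ZSpan.fundamentalDomain b) = 1 := by
    rw [ZSpan.volume_fundamentalDomain, hb, show of h = h from rfl, hdet]
    simp
  have : Countable (Submodule.span ℤ (Set.range b)).toAddSubgroup :=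
    inferInstanceAs (Countable (Submodule.span ℤ (Set.range b)))
  obtain ⟨⟨x, hx⟩, hx0, hxs⟩ :=
    MeasureTheory.exists_ne_zero_mem_lattice_of_measure_mul_two_pow_le_measure
      (s := Metric.closedBall (0 : Fin d → ℝ) 1)
      (ZSpan.isAddFundamentalDomain' b MeasureTheory.volume)
      (by simp) (convex_closedBall _ _) (isCompact_closedBall _ _)
      (by rw [hvol, Real.volume_pi_closedBall _ zero_le_one]; simp)
  obtain ⟨v, rfl⟩ := (Submodule.mem_span_range_iff_exists_fun ℤ).1 hx
  have hv : (fun i => (v i : ℝ)) ᵥ* h = ∑ i, v i • b i := by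
    rw [hb, vecMul_eq_sum]
    exact Finset.sum_congr rfl fun i _ => Int.cast_smul_eq_zsmul ℝ _ _
  refine ⟨v, ?_, ?_⟩
  · rintro rfl
    simp at hx0
  · rw [hv]
    simpa using hxs

theorem abs_dotProduct_le {d : ℕ} {x y : Fin d → ℝ} {a b : ℝ} (ha : 0 ≤ a)
    (hx : ∀ i, |x i| ≤ a) (hy : ∀ i, |y i| ≤ b) : |x ⬝ᵥ y| ≤ d * (a * b) := by
  calc |x ⬝ᵥ y| ≤ ∑ i, |x i * y i| := Finset.abs_sum_le_sum_abs _ _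
    _ ≤ ∑ _i : Fin d, a * b := Finset.sum_le_sum fun i _ => by
        rw [abs_mul]
        exact mul_le_mul (hx i) (hy i) (abs_nonneg _) ha
    _ = d * (a * b) := by simp

/-- A unimodular lattice without short vectors contains a vector of controlled length outside any
given hyperplane. -/
theorem exists_norm_vecMul_le_of_dotProduct_ne_zero {d : ℕ} (hd : 0 < d)
    (g : Matrix (Fin d) (Fin d) ℝ) (hdet : g.det = 1) {M : ℝ} (hM : 1 ≤ M)
    (hg : ∀ v : Fin d → ℤ, v ≠ 0 → 1 / M < ‖(fun i => (v i : ℝ)) ᵥ* g‖)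
    (n : Fin d → ℝ) (hn : n ⬝ᵥ n = 1) :
    ∃ v : Fin d → ℤ, ‖(fun i => (v i : ℝ)) ᵥ* g‖ ≤ 1 + d * M ^ d ∧
      ((fun i => (v i : ℝ)) ᵥ* g) ⬝ᵥ n ≠ 0 := by
  have hM0 : 0 < M := by linarith
  set c : ℝ := (M ^ d)⁻¹ - 1 with hc
  have hMd : 1 ≤ M ^ d := one_le_pow₀ hM
  have hc1 : |c| ≤ 1 := by
    have h1 : (M ^ d)⁻¹ ≤ 1 := inv_le_one_of_one_le₀ hMd
    have h2 : 0 < (M ^ d)⁻¹ := by positivity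
    rw [abs_le]
    constructor <;> linarith
  set S : Matrix (Fin d) (Fin d) ℝ :=
    M • (1 + replicateCol Unit n * replicateRow Unit (c • n)) with hS
  have hSdet : S.det = 1 := by
    rw [hS, det_smul, det_one_add_replicateCol_mul_replicateRow, smul_dotProduct, hn, hc]
    simp
    field_simp
  have hSmul : ∀ x : Fin d → ℝ, x ᵥ* S = M • (x + (c * (x ⬝ᵥ n)) • n) := by
    intro x
    rw [hS, vecMul_smul, vecMul_add, vecMul_one, ← vecMul_vecMul]
    congr 2
    ext i
    simp [vecMul, dotProduct]
    ring
  obtain ⟨v, hv0, hv⟩ := exists_ne_zero_norm_vecMul_le_one hd (g * S) (by simp [hdet, hSdet])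
  rw [← vecMul_vecMul, hSmul] at hv
  set x := (fun i => (v i : ℝ)) ᵥ* g with hx
  set y := M • (x + (c * (x ⬝ᵥ n)) • n) with hy
  have hni : ∀ i, |n i| ≤ 1 := by
    intro i
    rw [← sq_le_one_iff_abs_le_one, ← hn, sq]
    exact Finset.single_le_sum (f := fun i => n i * n i) (fun i _ => mul_self_nonneg _)
      (Finset.mem_univ i)
  have hyi : ∀ i, |y i| ≤ 1 := fun i => (norm_le_pi_norm y i).trans hv
  have hyn : y ⬝ᵥ n = M * (M ^ d)⁻¹ * (x ⬝ᵥ n) := by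
    rw [hy, smul_dotProduct, add_dotProduct, smul_dotProduct, hn, hc]
    simp
    ring
  have hxn : |x ⬝ᵥ n| ≤ d * M ^ d := by
    have h1 : |y ⬝ᵥ n| ≤ d * (1 * 1) := abs_dotProduct_le zero_le_one hyi hni
    have h2 : x ⬝ᵥ n = M⁻¹ * M ^ d * (y ⬝ᵥ n) := by
      rw [hyn]; field_simp
    have h3 : M⁻¹ ≤ 1 := inv_le_one_of_one_le₀ hM
    rw [h2, abs_mul, abs_of_nonneg (by positivity)]
    calc M⁻¹ * M ^ d * |y ⬝ᵥ n| ≤ 1 * M ^ d * (d * (1 * 1)) := by gcongr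
      _ = d * M ^ d := by ring
  refine ⟨v, ?_, fun h0 => ?_⟩
  · rw [pi_norm_le_iff_of_nonneg (by positivity)]
    intro i
    have h1 : x i = M⁻¹ * y i - c * (x ⬝ᵥ n) * n i := by
      rw [hy]; simp; field_simp; ring
    have h3 : M⁻¹ ≤ 1 := inv_le_one_of_one_le₀ hM
    change |x i| ≤ _
    rw [h1]
    calc |M⁻¹ * y i - c * (x ⬝ᵥ n) * n i| ≤ |M⁻¹ * y i| + |c * (x ⬝ᵥ n) * n i| := abs_sub _ _
      _ = M⁻¹ * |y i| + |c| * |x ⬝ᵥ n| * |n i| := by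
        rw [abs_mul, abs_mul, abs_mul, abs_of_nonneg (inv_nonneg.2 hM0.le)]
      _ ≤ 1 * 1 + 1 * (d * M ^ d) * 1 := by
        gcongr
        exacts [hyi i, hni i]
      _ = 1 + d * M ^ d := by ring
  · have h1 : M * ‖x‖ ≤ 1 := by
      rw [hy, h0] at hv
      simpa [norm_smul, abs_of_pos hM0] using hv
    have h2 := hg v hv0
    rw [div_lt_iff₀ hM0] at h2
    linarith

/-- A unimodular lattice without short vectors contains linearly independent vectors of controlled
length. -/
theorem exists_det_ne_zero_abs_mul_le {d : ℕ} (hd : 0 < d)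
    (g : Matrix (Fin d) (Fin d) ℝ) (hdet : g.det = 1) {M : ℝ} (hM : 1 ≤ M)
    (hg : ∀ v : Fin d → ℤ, v ≠ 0 → 1 / M < ‖(fun i => (v i : ℝ)) ᵥ* g‖) :
    ∃ A : Matrix (Fin d) (Fin d) ℤ, A.det ≠ 0 ∧
      ∀ i j, |(A.map (Int.cast : ℤ → ℝ) * g) i j| ≤ 1 + d * M ^ d := by
  set s : Set (Fin d → ℝ) := {x | ‖x‖ ≤ 1 + d * M ^ d ∧
    ∃ v : Fin d → ℤ, x = (fun i => (v i : ℝ)) ᵥ* g}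
  have htop : Submodule.span ℝ s = ⊤ := by
    by_contra hne
    obtain ⟨f, hf0, hf⟩ := Submodule.exists_le_ker_of_lt_top _ (lt_top_iff_ne_top.2 hne)
    obtain ⟨m, rfl⟩ := (dotProductEquiv ℝ (Fin d)).surjective f
    have hm0 : m ≠ 0 := fun h => hf0 (by simp [h])
    have hmm : 0 < m ⬝ᵥ m := by
      refine lt_of_le_of_ne (Finset.sum_nonneg fun i _ => mul_self_nonneg _) fun h => hm0 ?_
      exact dotProduct_self_eq_zero.1 h.symm
    obtain ⟨v, hv, hvn⟩ := exists_norm_vecMul_le_of_dotProduct_ne_zero hd g hdet hM hg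
      ((√(m ⬝ᵥ m))⁻¹ • m) (by
        rw [smul_dotProduct, dotProduct_smul, smul_eq_mul, smul_eq_mul, ← mul_assoc, ← mul_inv,
          Real.mul_self_sqrt hmm.le, inv_mul_cancel₀ hmm.ne'])
    have h1 : m ⬝ᵥ ((fun i => (v i : ℝ)) ᵥ* g) = 0 :=
      hf (Submodule.subset_span (s := s) ⟨hv, v, rfl⟩)
    apply hvn
    rw [dotProduct_smul, (dotProduct_comm _ _).trans h1, smul_zero]
  obtain ⟨f, hfs, -, hfi⟩ := Submodule.exists_fun_fin_finrank_span_eq ℝ s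
  have hrank : Module.finrank ℝ (Submodule.span ℝ s) = d := by
    rw [htop, finrank_top]; simp
  obtain ⟨f, hfs, hfi⟩ : ∃ f : Fin d → Fin d → ℝ, (∀ i, f i ∈ s) ∧ LinearIndependent ℝ f :=
    ⟨f ∘ finCongr hrank.symm, fun i => hfs _, hfi.comp _ (finCongr hrank.symm).injective⟩
  choose hfT v hv using hfs
  have hmul : (of v).map (Int.cast : ℤ → ℝ) * g = of f := by
    ext i j
    rw [of_apply, hv i]
    rfl
  refine ⟨of v, fun h0 => ?_, fun i j => ?_⟩
  · have h1 : IsUnit (of f).det :=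
      (isUnit_iff_isUnit_det _).1 (linearIndependent_rows_iff_isUnit.1 hfi)
    rw [← hmul, det_mul, ← Int.cast_det, h0] at h1
    simp at h1
  · rw [hmul]
    exact (norm_le_pi_norm (f i) j).trans (hfT i)

/-- A nonsingular integer matrix that is not unimodular has a row whose replacement by a
combination of the rows with coefficients in `[-1/2, 1/2]` is again integral and nonsingular. -/
theorem exists_updateRow_integral {d : ℕ} (A : Matrix (Fin d) (Fin d) ℤ) (h0 : A.det ≠ 0)
    (h1 : A.det.natAbs ≠ 1) :
    ∃ (i : Fin d) (x : Fin d → ℤ) (c : Fin d → ℝ), (∀ k, |c k| ≤ 1 / 2) ∧ c i ≠ 0 ∧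
      (fun k => (x k : ℝ)) = c ᵥ* A.map (Int.cast : ℤ → ℝ) := by
  set B : Matrix (Fin d) (Fin d) ℝ := A.map Int.cast with hB
  have hBu : IsUnit B.det := by
    rw [hB, ← Int.cast_det]
    exact (Int.cast_ne_zero.2 h0).isUnit
  obtain ⟨j, i, hji⟩ : ∃ j i, ∀ z : ℤ, B⁻¹ j i ≠ z := by
    by_contra! hcon
    choose Z hZ using hcon
    have hZB : B⁻¹ = (of Z).map (Int.cast : ℤ → ℝ) := by ext a b; exact hZ a b
    have hdet : ((of Z).det * A.det : ℤ) = 1 := by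
      have := det_nonsing_inv_mul_det B hBu
      rw [hZB, hB, ← Int.cast_det, ← Int.cast_det] at this
      exact_mod_cast this
    exact h1 (Int.isUnit_iff_natAbs_eq.1 (IsUnit.of_mul_eq_one_right _ hdet))
  refine ⟨i, Pi.single j 1 - (fun k => round (B⁻¹ j k)) ᵥ* A,
    fun k => B⁻¹ j k - round (B⁻¹ j k), fun k => abs_sub_round _, sub_ne_zero.2 (hji _), ?_⟩
  have hBB : (fun k => B⁻¹ j k) ᵥ* B = Pi.single j 1 := by
    ext k
    have := congr_fun (congr_fun (nonsing_inv_mul B hBu) j) k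
    rw [mul_apply] at this
    rw [vecMul, dotProduct, this, one_apply, Pi.single_apply]
    simp [eq_comm]
  rw [show (fun k => B⁻¹ j k - (round (B⁻¹ j k) : ℝ)) =
    (fun k => B⁻¹ j k) - fun k => (round (B⁻¹ j k) : ℝ) from rfl, sub_vecMul, hBB]
  ext k
  simp [vecMul, dotProduct, hB, Pi.single_apply]

/-- Independent lattice vectors can be replaced by a basis of the lattice at the cost of a power of
the index. -/
theorem exists_natAbs_det_eq_one_abs_mul_le {d : ℕ} (hd : 0 < d) (g : Matrix (Fin d) (Fin d) ℝ)
    (A : Matrix (Fin d) (Fin d) ℤ) (h0 : A.det ≠ 0) {T : ℝ} (hT : 0 ≤ T)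
    (hA : ∀ i j, |(A.map (Int.cast : ℤ → ℝ) * g) i j| ≤ T) :
    ∃ U : Matrix (Fin d) (Fin d) ℤ, U.det.natAbs = 1 ∧
      ∀ i j, |(U.map (Int.cast : ℤ → ℝ) * g) i j| ≤ T * |(A.det : ℝ)| ^ d := by
  induction hm : A.det.natAbs using Nat.strong_induction_on generalizing A T with
  | _ m ih =>
  by_cases h1 : A.det.natAbs = 1
  · refine ⟨A, h1, fun i j => (hA i j).trans (le_of_eq ?_)⟩
    rw [← Int.cast_abs, Int.abs_eq_natAbs, h1]
    simp
  obtain ⟨i, x, c, hc, hci, hx⟩ := exists_updateRow_integral A h0 h1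
  have hmap : (A.updateRow i x).map (Int.cast : ℤ → ℝ) =
      (A.map Int.cast).updateRow i (∑ k, c k • A.map (Int.cast : ℤ → ℝ) k) := by
    rw [map_updateRow]
    congr 1
    rw [← vecMul_eq_sum]
    exact hx
  have hdet : ((A.updateRow i x).det : ℝ) = c i * A.det := by
    rw [Int.cast_det, hmap, det_updateRow_sum, smul_eq_mul, Int.cast_det]
  have hdet0 : (A.updateRow i x).det ≠ 0 := by
    rw [← Int.cast_ne_zero (α := ℝ), hdet]
    exact mul_ne_zero hci (Int.cast_ne_zero.2 h0)
  have hA0 : 0 < |(A.det : ℝ)| := abs_pos.2 (Int.cast_ne_zero.2 h0)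
  have hdet_le : |((A.updateRow i x).det : ℝ)| ≤ |(A.det : ℝ)| / 2 := by
    rw [hdet, abs_mul]
    have := mul_le_mul_of_nonneg_right (hc i) hA0.le
    linarith
  have hlt : (A.updateRow i x).det.natAbs < m := by
    have h2 : |((A.updateRow i x).det : ℝ)| < |(A.det : ℝ)| := by linarith
    rw [← hm, ← Int.ofNat_lt, Int.natCast_natAbs, Int.natCast_natAbs]
    exact_mod_cast h2
  have hd1 : (1 : ℝ) ≤ d := by exact_mod_cast hd
  obtain ⟨U, hU, hUg⟩ := ih _ hlt (A.updateRow i x) hdet0 (T := d * T) (by positivity)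
    (by
      intro a b
      rw [hmap, updateRow_mul]
      by_cases hai : a = i
      · subst hai
        rw [updateRow_self, ← vecMul_eq_sum, vecMul_vecMul]
        have := abs_dotProduct_le (x := c) (y := fun k => (A.map (Int.cast : ℤ → ℝ) * g) k b)
          (by norm_num) hc (fun k => hA k b)
        refine this.trans ?_
        gcongr
        linarith
      · rw [updateRow_ne hai]
        exact (hA a b).trans (le_mul_of_one_le_left hT hd1))
    rfl
  refine ⟨U, hU, fun a b => (hUg a b).trans ?_⟩
  have h2d : (d : ℝ) ≤ 2 ^ d := by exact_mod_cast Nat.lt_two_pow_self.le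
  calc d * T * |((A.updateRow i x).det : ℝ)| ^ d ≤ d * T * (|(A.det : ℝ)| / 2) ^ d := by gcongr
    _ = T * |(A.det : ℝ)| ^ d * (d / 2 ^ d) := by rw [div_pow]; ring
    _ ≤ T * |(A.det : ℝ)| ^ d * 1 := by
      gcongr
      exact (div_le_one (by positivity)).2 h2d
    _ = T * |(A.det : ℝ)| ^ d := mul_one _

theorem abs_det_le {d : ℕ} {M : Matrix (Fin d) (Fin d) ℝ} {B : ℝ} (hM : ∀ i j, |M i j| ≤ B) :
    |M.det| ≤ d.factorial * B ^ d := by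
  simpa using det_le (abv := AbsoluteValue.abs) hM

theorem abs_adjugate_le {d : ℕ} {M : Matrix (Fin d) (Fin d) ℝ} {B : ℝ} (hB : 1 ≤ B)
    (hM : ∀ i j, |M i j| ≤ B) (i j : Fin d) : |M.adjugate i j| ≤ d.factorial * B ^ d := by
  rw [adjugate_apply]
  refine abs_det_le fun a b => ?_
  rw [updateRow_apply]
  split_ifs
  · rw [Pi.single_apply]
    split_ifs <;> simp <;> linarith
  · exact hM a b

theorem euclNorm_le {d : ℕ} {x : Fin d → ℝ} {c : ℝ} (hc : 0 ≤ c) (hx : ∀ i, |x i| ≤ c) :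
    euclNorm x ≤ d * c := by
  refine Real.sqrt_le_iff.2 ⟨by positivity, ?_⟩
  have hd : (d : ℝ) ≤ (d : ℝ) ^ 2 := by exact_mod_cast Nat.le_self_pow two_ne_zero d
  calc ∑ i, x i ^ 2 ≤ ∑ _i : Fin d, c ^ 2 := by
        gcongr ∑ _i, ?_ with i
        exact sq_le_sq.2 ((hx i).trans (le_abs_self c))
    _ = d * c ^ 2 := by simp
    _ ≤ (d : ℝ) ^ 2 * c ^ 2 := by gcongr
    _ = (d * c) ^ 2 := by ring

theorem abs_le_euclNorm {d : ℕ} (x : Fin d → ℝ) (i : Fin d) : |x i| ≤ euclNorm x :=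
  Real.abs_le_sqrt (Finset.single_le_sum (f := fun i => x i ^ 2) (fun _ _ => sq_nonneg _)
    (Finset.mem_univ i))

theorem opNorm_le {d : ℕ} {M : Matrix (Fin d) (Fin d) ℝ} {B : ℝ} (hB : 0 ≤ B)
    (hM : ∀ i j, |M i j| ≤ B) : opNorm M ≤ d * (d * B) := by
  refine Real.sSup_le ?_ (by positivity)
  rintro _ ⟨v, hv, rfl⟩
  refine euclNorm_le (by positivity) fun i => ?_
  have := abs_dotProduct_le hB (hM i) fun j => (abs_le_euclNorm v j).trans hv
  rwa [mul_one] at this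

theorem systole_le {d : ℕ} (g : Matrix (Fin d) (Fin d) ℝ) {v : Fin d → ℤ} (hv : v ≠ 0) :
    systole g ≤ euclNorm ((fun i => (v i : ℝ)) ᵥ* g) := by
  refine csInf_le ⟨0, ?_⟩ ⟨v, hv, rfl⟩
  rintro _ ⟨w, -, rfl⟩
  exact Real.sqrt_nonneg _

/-- Quantitative reduction theory for `SL(d,ℤ)`, in terms of matrix entries. -/
theorem exists_toSLR_mul_abs_le {d : ℕ} (hd : 0 < d) (g : SpecialLinearGroup (Fin d) ℝ) {R : ℝ}
    (hR : 1 ≤ R) (hg : 1 / R ≤ systole (g : Matrix (Fin d) (Fin d) ℝ)) {T : ℝ}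
    (hT : T = 1 + d * (2 * d * R) ^ d) :
    ∃ γ : SpecialLinearGroup (Fin d) ℤ, ∀ i j,
      |(toSLR γ * g : SpecialLinearGroup (Fin d) ℝ) i j| ≤ T * (d.factorial * T ^ d) ^ d := by
  have hd1 : (1 : ℝ) ≤ d := by exact_mod_cast hd
  have hM : 1 ≤ 2 * d * R := by nlinarith
  have hT0 : 0 ≤ T := by rw [hT]; positivity
  obtain ⟨A, hA0, hA⟩ := exists_det_ne_zero_abs_mul_le hd g.1 g.2 hM fun v hv => by
    have h1 := (hg.trans (systole_le _ hv)).trans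
      (euclNorm_le (norm_nonneg _) (norm_le_pi_norm ((fun i => (v i : ℝ)) ᵥ* g.1)))
    rw [div_le_iff₀ (by positivity)] at h1
    rw [div_lt_iff₀ (by positivity)]
    linarith
  rw [← hT] at hA
  obtain ⟨U, hU, hUg⟩ := exists_natAbs_det_eq_one_abs_mul_le hd g.1 A hA0 hT0 hA
  have hAdet : |(A.det : ℝ)| ≤ d.factorial * T ^ d := by
    have := abs_det_le hA
    rwa [det_mul, g.2, mul_one, ← Int.cast_det] at this
  let D : Fin d → ℤ := fun a => if a = ⟨0, hd⟩ then U.det else 1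
  have hD : ∀ a, |(D a : ℝ)| = 1 := by
    intro a
    have : |D a| = 1 := by
      simp only [D]
      split_ifs
      · rw [Int.abs_eq_natAbs, hU, Nat.cast_one]
      · exact abs_one
    exact_mod_cast this
  have hdet : (diagonal D * U).det = 1 := by
    rw [det_mul, det_diagonal]
    simp only [D, Finset.prod_ite_eq', Finset.mem_univ, if_true]
    exact Int.isUnit_mul_self (Int.isUnit_iff_natAbs_eq.2 hU)
  let γ : SpecialLinearGroup (Fin d) ℤ := ⟨diagonal D * U, hdet⟩
  refine ⟨γ, fun i j => ?_⟩
  have hγ : ((toSLR γ : SpecialLinearGroup (Fin d) ℝ) : Matrix (Fin d) (Fin d) ℝ) =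
      (diagonal D * U).map (Int.cast : ℤ → ℝ) := rfl
  have heq : (toSLR γ * g : SpecialLinearGroup (Fin d) ℝ) i j =
      D i * (U.map (Int.cast : ℤ → ℝ) * g.1) i j := by
    change ((toSLR γ : SpecialLinearGroup (Fin d) ℝ).1 * g.1) i j = _
    rw [hγ, mul_apply, mul_apply, Finset.mul_sum]
    simp only [map_apply, diagonal_mul, Int.cast_mul, mul_assoc]
  rw [heq, abs_mul, hD, one_mul]
  exact (hUg i j).trans (by gcongr)

theorem exists_eval_le_pow (p : Polynomial ℝ) : ∃ N : ℕ, ∀ R : ℝ, R > 2 → p.eval R ≤ R ^ N := by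
  induction p using Polynomial.induction_on' with
  | add p q hp hq =>
    obtain ⟨N, hN⟩ := hp
    obtain ⟨M, hM⟩ := hq
    refine ⟨N + M + 1, fun R hR => ?_⟩
    have h1 : R ^ N ≤ R ^ (N + M) := pow_le_pow_right₀ (by linarith) (by omega)
    have h2 : R ^ M ≤ R ^ (N + M) := pow_le_pow_right₀ (by linarith) (by omega)
    have h3 : 0 ≤ R ^ (N + M) := pow_nonneg (by linarith) _
    rw [Polynomial.eval_add, pow_succ]
    nlinarith [hN R hR, hM R hR]
  | monomial n a =>
    refine ⟨⌈a⌉₊ + n, fun R hR => ?_⟩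
    rw [Polynomial.eval_monomial, pow_add]
    refine mul_le_mul_of_nonneg_right ?_ (pow_nonneg (by linarith) _)
    calc a ≤ ⌈a⌉₊ := Nat.le_ceil a
      _ ≤ 2 ^ ⌈a⌉₊ := by exact_mod_cast Nat.lt_two_pow_self.le
      _ ≤ R ^ ⌈a⌉₊ := pow_le_pow_left₀ zero_le_two hR.le _

/-- Every element of the group is brought into a finite-index subgroup by left multiplication with
an integer matrix whose entries are bounded in terms of the subgroup only. -/
theorem exists_bound_forall_exists_mul_mem {d : ℕ} (Γ : Subgroup (SpecialLinearGroup (Fin d) ℤ))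
    (hΓ : Γ.FiniteIndex) : ∃ K : ℕ, ∀ γ, ∃ ρ : SpecialLinearGroup (Fin d) ℤ, ρ * γ ∈ Γ ∧
      ∀ i j, |((toSLR ρ : SpecialLinearGroup (Fin d) ℝ) i j)| ≤ K := by
  obtain ⟨K, hK⟩ := Finite.exists_le
    fun x : (SpecialLinearGroup (Fin d) ℤ ⧸ Γ) × Fin d × Fin d => (x.1.out⁻¹ x.2.1 x.2.2).natAbs
  refine ⟨K, fun γ => ⟨(γ : SpecialLinearGroup (Fin d) ℤ ⧸ Γ).out⁻¹, ?_, fun i j => ?_⟩⟩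
  · rw [← QuotientGroup.eq, QuotientGroup.out_eq']
  · have h1 := hK ((γ : SpecialLinearGroup (Fin d) ℤ ⧸ Γ), i, j)
    have h2 : |(γ : SpecialLinearGroup (Fin d) ℤ ⧸ Γ).out⁻¹ i j| ≤ (K : ℤ) := by
      rw [Int.abs_eq_natAbs]
      exact_mod_cast h1
    change |(((γ : SpecialLinearGroup (Fin d) ℤ ⧸ Γ).out⁻¹ i j : ℤ) : ℝ)| ≤ K
    exact_mod_cast h2

theorem stmt7 (d : ℕ) (hd : 2 ≤ d)
    (Γ : Subgroup (Matrix.SpecialLinearGroup (Fin d) ℤ)) (hΓ : Γ.FiniteIndex) :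
    ∃ C₉ > (1 : ℝ), ∀ R : ℝ, R > 2 →
      ∀ g : Matrix.SpecialLinearGroup (Fin d) ℝ,
        1 / R ≤ systole (g : Matrix (Fin d) (Fin d) ℝ) →
        ∃ γ ∈ Γ,
          opNorm ((toSLR γ * g : Matrix.SpecialLinearGroup (Fin d) ℝ) :
              Matrix (Fin d) (Fin d) ℝ) ≤ R ^ C₉ ∧
          opNorm (((toSLR γ * g)⁻¹ : Matrix.SpecialLinearGroup (Fin d) ℝ) :
              Matrix (Fin d) (Fin d) ℝ) ≤ R ^ C₉ := by
  obtain ⟨K, hK⟩ := exists_bound_forall_exists_mul_mem Γ hΓ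
  let t : Polynomial ℝ := 1 + (d : Polynomial ℝ) * (2 * (d : Polynomial ℝ) * Polynomial.X) ^ d
  let e : Polynomial ℝ := 1 + (d : Polynomial ℝ) * (K * (t * (d.factorial * t ^ d) ^ d))
  obtain ⟨N, hN⟩ := exists_eval_le_pow ((d : Polynomial ℝ) * (d * e))
  obtain ⟨N', hN'⟩ := exists_eval_le_pow ((d : Polynomial ℝ) * (d * (d.factorial * e ^ d)))
  refine ⟨(N + N' + 2 : ℕ), by exact_mod_cast (by omega : 1 < N + N' + 2), fun R hR g hg => ?_⟩
  have hR1 : 1 ≤ R := by linarith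
  obtain ⟨γ, hγ⟩ := exists_toSLR_mul_abs_le (by omega) g hR1 hg (T := t.eval R) (by simp [t])
  obtain ⟨ρ, hρ, hρK⟩ := hK γ
  have ht0 : 0 ≤ t.eval R := by
    simp only [t, Polynomial.eval_add, Polynomial.eval_one, Polynomial.eval_mul,
      Polynomial.eval_natCast, Polynomial.eval_pow, Polynomial.eval_ofNat, Polynomial.eval_X]
    positivity
  have he : e.eval R = 1 + d * (K * (t.eval R * (d.factorial * t.eval R ^ d) ^ d)) := by
    simp [e]
  have he1 : 1 ≤ e.eval R := by
    rw [he]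
    exact le_add_of_nonneg_right (by positivity)
  have hentry : ∀ i j, |(toSLR (ρ * γ) * g : SpecialLinearGroup (Fin d) ℝ) i j| ≤ e.eval R := by
    intro i j
    rw [map_mul, mul_assoc, he]
    have := abs_dotProduct_le (Nat.cast_nonneg K) (hρK i) fun k => hγ k j
    exact this.trans (le_add_of_nonneg_left zero_le_one)
  refine ⟨ρ * γ, hρ, ?_, ?_⟩
  · refine (opNorm_le (by linarith) hentry).trans ?_
    rw [Real.rpow_natCast]
    refine le_trans ?_ ((hN R hR).trans (pow_le_pow_right₀ hR1 (by omega)))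
    simp
  · refine (opNorm_le (by positivity) (abs_adjugate_le he1 hentry)).trans ?_
    rw [Real.rpow_natCast]
    refine le_trans ?_ ((hN' R hR).trans (pow_le_pow_right₀ hR1 (by omega)))
    simp
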